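/- For every natural number d ≥ 2, the limit as T → ∞ of ∫_0^T (g^{(d−1)}(x) / x) dx, where g(t) := (sin t)^d and g^{(d−1)} denotes its (d−1)-st iterated derivative, exists and equals (d−1)! · ∫_0^∞ (sin x / x)^d dx. -/

import Mathlib

open Filter Topology

open MeasureTheory in
theorem integrable_sinc_pow {d : ℕ} (hd : 2 ≤ d) :
    Integrable (fun x : ℝ => Real.sinc x ^ d) := by
  refine (integrable_inv_one_add_sq.const_mul 2).mono'
    (Real.continuous_sinc.pow d).aestronglyMeasurable (ae_of_all _ fun x => ?_)
  have hsq : |Real.sinc x| ^ 2 * (1 + x ^ 2) ≤ 2 := by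
    have h₁ : |Real.sinc x| ^ 2 ≤ 1 := pow_le_one₀ (abs_nonneg _) (Real.abs_sinc_le_one x)
    have h₂ : |Real.sinc x| ^ 2 * x ^ 2 ≤ 1 := by
      rcases eq_or_ne x 0 with rfl | hx
      · simp
      · rw [sq_abs, Real.sinc_of_ne_zero hx, div_pow, div_mul_cancel₀ _ (pow_ne_zero 2 hx)]
        exact Real.sin_sq_le_one x
    linarith
  calc ‖Real.sinc x ^ d‖ = |Real.sinc x| ^ d := by rw [norm_pow, Real.norm_eq_abs]
    _ ≤ |Real.sinc x| ^ 2 := pow_le_pow_of_le_one (abs_nonneg _) (Real.abs_sinc_le_one x) hd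
    _ ≤ 2 * (1 + x ^ 2)⁻¹ := by
      rw [← div_eq_mul_inv, le_div_iff₀ (by positivity)]
      exact hsq

open scoped ContDiff in
/-- The `k`-th derivative of `sin ^ (k + m)` is still divisible by `sin ^ m`. -/
theorem iteratedDeriv_sin_pow_eq (k m : ℕ) :
    ∃ p : ℝ → ℝ, ContDiff ℝ ∞ p ∧
      iteratedDeriv k (fun t : ℝ => Real.sin t ^ (k + m)) = fun x => Real.sin x ^ m * p x := by
  induction k generalizing m with
  | zero => exact ⟨fun _ => 1, contDiff_const, by simp⟩
  | succ k ih =>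
    obtain ⟨p, hp, h⟩ := ih (m + 1)
    have hdp : ContDiff ℝ ∞ (deriv p) := (contDiff_infty_iff_deriv.1 hp).2
    refine ⟨fun x => (m + 1) * Real.cos x * p x + Real.sin x * deriv p x, ?_, ?_⟩
    · exact ((contDiff_const.mul Real.contDiff_cos).mul hp).add (Real.contDiff_sin.mul hdp)
    · rw [iteratedDeriv_succ, show k + 1 + m = k + (m + 1) by omega, h]
      ext x
      have hd := ((Real.hasDerivAt_sin x).pow (m + 1)).mul
        (hp.differentiable (by simp) x).hasDerivAt
      refine hd.deriv.trans ?_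
      simp
      ring

theorem contDiff_sin_pow (d : ℕ) {n : WithTop ℕ∞} :
    ContDiff ℝ n (fun t : ℝ => Real.sin t ^ d) :=
  Real.contDiff_sin.pow d

theorem exists_abs_iteratedDeriv_sin_pow_le (k d : ℕ) :
    ∃ C, ∀ x, |iteratedDeriv k (fun t : ℝ => Real.sin t ^ d) x| ≤ C := by
  have hper : (iteratedDeriv k fun t : ℝ => Real.sin t ^ d).Periodic (2 * Real.pi) := fun x => by
    have h := congrFun (iteratedDeriv_comp_add_const (n := k)
      (f := fun t : ℝ => Real.sin t ^ d) (s := 2 * Real.pi)) x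
    simpa only [Real.sin_add_two_pi] using h.symm
  have hcont : Continuous (iteratedDeriv k fun t : ℝ => Real.sin t ^ d) :=
    (contDiff_sin_pow d (n := k)).continuous_iteratedDeriv k le_rfl
  obtain ⟨C, hC⟩ := isCompact_Icc.exists_bound_of_continuousOn
    (s := Set.Icc 0 (2 * Real.pi)) hcont.continuousOn
  refine ⟨C, fun x => ?_⟩
  obtain ⟨y, hy, hxy⟩ := hper.exists_mem_Ico₀ Real.two_pi_pos x
  rw [hxy]
  exact hC y (Set.Ico_subset_Icc_self hy)

theorem tendsto_iteratedDeriv_sin_pow_div_pow_atTop (k m d : ℕ) :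
    Tendsto (fun x : ℝ => iteratedDeriv k (fun t : ℝ => Real.sin t ^ d) x / x ^ (m + 1))
      atTop (𝓝 0) := by
  obtain ⟨C, hC⟩ := exists_abs_iteratedDeriv_sin_pow_le k d
  have h₀ : Tendsto (fun x : ℝ => C / x ^ (m + 1)) atTop (𝓝 0) :=
    (tendsto_pow_atTop (Nat.succ_ne_zero m)).const_div_atTop C
  refine squeeze_zero_norm' ?_ h₀
  filter_upwards [eventually_gt_atTop 0] with x hx
  rw [norm_div, Real.norm_eq_abs, Real.norm_of_nonneg (pow_nonneg hx.le _)]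
  exact div_le_div_of_nonneg_right (hC x) (pow_nonneg hx.le _)

theorem continuous_iteratedDeriv_sin_pow_div_pow (k m : ℕ) :
    Continuous fun x : ℝ =>
      iteratedDeriv k (fun t : ℝ => Real.sin t ^ (k + (m + 1))) x / x ^ m := by
  obtain ⟨p, hp, h⟩ := iteratedDeriv_sin_pow_eq k (m + 1)
  have hc : Continuous fun x => Real.sinc x ^ m * (Real.sin x * p x) :=
    (Real.continuous_sinc.pow m).mul (Real.continuous_sin.mul hp.continuous)
  convert hc using 2 with x
  rw [h]
  rcases eq_or_ne x 0 with rfl | hx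
  · simp
  · simp only [Real.sinc_of_ne_zero hx, div_pow]
    ring

theorem intervalIntegrable_iteratedDeriv_sin_pow_div_pow (k m : ℕ) (a b : ℝ) :
    IntervalIntegrable (fun x : ℝ =>
      iteratedDeriv k (fun t : ℝ => Real.sin t ^ (k + m)) x / x ^ m) MeasureTheory.volume a b := by
  obtain ⟨p, hp, h⟩ := iteratedDeriv_sin_pow_eq k m
  have hc : Continuous fun x => Real.sinc x ^ m * p x :=
    (Real.continuous_sinc.pow m).mul hp.continuous
  refine (hc.intervalIntegrable a b).congr_ae (MeasureTheory.ae_restrict_of_ae ?_)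
  filter_upwards [MeasureTheory.Measure.ae_ne MeasureTheory.volume 0] with x hx
  rw [h]
  simp only [Real.sinc_of_ne_zero hx, div_pow]
  ring

/-- Integration by parts against `x ↦ 1 / x ^ (m + 1)`. -/
theorem integral_iteratedDeriv_sin_pow_div_pow (k m : ℕ) {T : ℝ} (hT : 0 ≤ T) :
    ∫ x in (0 : ℝ)..T,
        iteratedDeriv (k + 1) (fun t : ℝ => Real.sin t ^ (k + (m + 2))) x / x ^ (m + 1) =
      iteratedDeriv k (fun t : ℝ => Real.sin t ^ (k + (m + 2))) T / T ^ (m + 1) +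
        (m + 1) * ∫ x in (0 : ℝ)..T,
          iteratedDeriv k (fun t : ℝ => Real.sin t ^ (k + (m + 2))) x / x ^ (m + 2) := by
  have hint₀ := intervalIntegrable_iteratedDeriv_sin_pow_div_pow k (m + 2) 0 T
  have hint₁ := intervalIntegrable_iteratedDeriv_sin_pow_div_pow (k + 1) (m + 1) 0 T
  rw [show k + 1 + (m + 1) = k + (m + 2) by omega] at hint₁
  have hftc := intervalIntegral.integral_eq_sub_of_hasDerivAt_of_le hT
    (continuous_iteratedDeriv_sin_pow_div_pow k (m + 1)).continuousOn (fun x hx => ?_)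
    (hint₁.sub (hint₀.const_mul (m + 1 : ℝ)))
  · rw [intervalIntegral.integral_sub hint₁ (hint₀.const_mul _),
      intervalIntegral.integral_const_mul] at hftc
    simp only [zero_pow (Nat.succ_ne_zero m), div_zero, sub_zero] at hftc
    exact sub_eq_iff_eq_add.1 hftc
  · have hx0 : x ≠ 0 := hx.1.ne'
    have hdiff : DifferentiableAt ℝ
        (iteratedDeriv k fun t : ℝ => Real.sin t ^ (k + (m + 2))) x :=
      (contDiff_sin_pow _ (n := ⊤)).differentiable_iteratedDeriv k (by simp) x
    have hd := hdiff.hasDerivAt.div (hasDerivAt_pow (m + 1) x) (pow_ne_zero _ hx0)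
    rw [← iteratedDeriv_succ] at hd
    refine hd.congr_deriv ?_
    push_cast
    field_simp
    ring

theorem tendsto_integral_iteratedDeriv_sin_pow_div_pow (k m : ℕ) (hd : 2 ≤ k + (m + 1)) :
    Tendsto
      (fun T : ℝ => ∫ x in (0 : ℝ)..T,
        iteratedDeriv k (fun t : ℝ => Real.sin t ^ (k + (m + 1))) x / x ^ (m + 1))
      atTop
      (𝓝 (((k + m).descFactorial k : ℝ) *
        ∫ x in Set.Ioi (0 : ℝ), (Real.sin x / x) ^ (k + (m + 1)))) := by
  induction k generalizing m with
  | zero =>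
    simp only [zero_add] at hd ⊢
    have hint : MeasureTheory.IntegrableOn (fun x : ℝ => (Real.sin x / x) ^ (m + 1))
        (Set.Ioi 0) :=
      (integrable_sinc_pow hd).integrableOn.congr_fun
        (fun x hx => by simp only [Real.sinc_of_ne_zero (ne_of_gt hx)]) measurableSet_Ioi
    simpa [div_pow] using
      MeasureTheory.intervalIntegral_tendsto_integral_Ioi 0 hint tendsto_id
  | succ k ih =>
    have hlim := (tendsto_iteratedDeriv_sin_pow_div_pow_atTop k m (k + (m + 2))).add
      ((ih (m + 1) (by omega)).const_mul (m + 1 : ℝ))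
    have hfac : ((k + 1 + m).descFactorial (k + 1) : ℝ) =
        (m + 1) * ((k + (m + 1)).descFactorial k : ℝ) := by
      rw [show k + 1 + m = k + (m + 1) by omega, Nat.descFactorial_succ, Nat.add_sub_cancel_left]
      push_cast
      ring
    rw [hfac, mul_assoc, show k + 1 + (m + 1) = k + (m + 2) by omega]
    rw [zero_add] at hlim
    refine hlim.congr' ?_
    filter_upwards [eventually_ge_atTop 0] with T hT
    exact (integral_iteratedDeriv_sin_pow_div_pow k m hT).symm

/-- For every natural number `d ≥ 2`, the limit as `T → ∞` of
`∫_0^T (g^{(d−1)}(x) / x) dx`, where `g(t) := (sin t)^d`, exists and equals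
`(d−1)! · ∫_0^∞ (sin x / x)^d dx` (Lebesgue integral on the right). -/
theorem improper_integral_iterated_deriv (d : ℕ) (hd : 2 ≤ d) :
    Tendsto
      (fun T : ℝ =>
        ∫ x in (0 : ℝ)..T, iteratedDeriv (d - 1) (fun t : ℝ => Real.sin t ^ d) x / x)
      atTop
      (𝓝 ((Nat.factorial (d - 1) : ℝ) * ∫ x in Set.Ioi (0 : ℝ), (Real.sin x / x) ^ d)) := by
  obtain ⟨k, rfl⟩ : ∃ k, d = k + 1 := ⟨d - 1, by omega⟩
  simpa [Nat.descFactorial_self] using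
    tendsto_integral_iteratedDeriv_sin_pow_div_pow k 0 hd
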